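/- Let E be a bounded Lipschitz domain and let v ∈ H^1(E) satisfy Δv ∈ P_m(E) and v|_{∂E} = g for given continuous piecewise-polynomial boundary data g. Then v is uniquely determined by g together with the moments ∫_E v q for q ∈ P_m(E). -/

import Mathlib

open MeasureTheory

noncomputable section

local notation "ℝ²" => EuclideanSpace ℝ (Fin 2)

/-- `p` is (the restriction of) a bivariate real polynomial of total degree `≤ k`. -/
def IsPolyDeg (k : ℕ) (p : ℝ² → ℝ) : Prop :=
  ∃ q : MvPolynomial (Fin 2) ℝ, q.totalDegree ≤ k ∧
    ∀ x : ℝ², p x = MvPolynomial.eval (fun i => x i) q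

/-- Laplacian of `v` at `x`, computed from derivatives within the open set `E`. -/
def lapWithin (E : Set ℝ²) (v : ℝ² → ℝ) (x : ℝ²) : ℝ :=
  ∑ i : Fin 2,
    iteratedFDerivWithin ℝ 2 v E x
      ![EuclideanSpace.single i 1, EuclideanSpace.single i 1]

section Cutoff

variable {V : Type*} [NormedAddCommGroup V] [NormedSpace ℝ V]

/-- If `u` vanishes on the boundary of `E` and `φ` vanishes near `0`, then `φ ∘ u * h`, extended
by zero outside `E`, vanishes near every point outside `E`. -/
lemma indicator_comp_mul_eventuallyEq_zero {X : Type*} [TopologicalSpace X] {E : Set X}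
    (hE : IsOpen E) {u : X → ℝ} (h : X → ℝ)
    (hu : ContinuousOn u (closure E)) (hu0 : ∀ x ∈ frontier E, u x = 0) {φ : ℝ → ℝ}
    {ε : ℝ} (hε : 0 < ε) (hφ0 : ∀ t, |t| < ε → φ t = 0) {x : X} (hx : x ∉ E) :
    (E.indicator fun x => φ (u x) * h x) =ᶠ[nhds x] fun _ => 0 := by
  have h1 : ∀ᶠ y in nhds x, y ∈ E → |u y| < ε := by
    by_cases hxc : x ∈ closure E
    · have hx0 : u x = 0 := hu0 x ⟨hxc, by rwa [hE.interior_eq]⟩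
      have h2 : ∀ᶠ y in nhdsWithin x (closure E), |u y| < ε := by
        refine (hu x hxc).abs.eventually_lt_const ?_
        simpa [hx0] using hε
      filter_upwards [eventually_nhdsWithin_iff.1 h2] with y hy hyE
      exact hy (subset_closure hyE)
    · filter_upwards [isClosed_closure.isOpen_compl.mem_nhds hxc] with y hy hyE
      exact absurd (subset_closure hyE) hy
  filter_upwards [h1] with y hy
  by_cases hyE : y ∈ E
  · simp [hyE, hφ0 _ (hy hyE)]
  · simp [hyE]

lemma contDiff_indicator_comp_mul {E : Set V} (hE : IsOpen E) {u h : V → ℝ}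
    (hu : ContinuousOn u (closure E)) (hu0 : ∀ x ∈ frontier E, u x = 0) {n : WithTop ℕ∞}
    (hun : ContDiffOn ℝ n u E) (hhn : ContDiffOn ℝ n h E) {φ : ℝ → ℝ} (hφ : ContDiff ℝ n φ)
    {ε : ℝ} (hε : 0 < ε) (hφ0 : ∀ t, |t| < ε → φ t = 0) :
    ContDiff ℝ n (E.indicator fun x => φ (u x) * h x) := by
  rw [contDiff_iff_contDiffAt]
  intro x
  by_cases hx : x ∈ E
  · have hmem := hE.mem_nhds hx
    have h1 : ContDiffAt ℝ n (fun x => φ (u x) * h x) x :=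
      (hφ.contDiffAt.comp x (hun.contDiffAt hmem)).mul (hhn.contDiffAt hmem)
    refine h1.congr_of_eventuallyEq ?_
    filter_upwards [hmem] with y hy
    exact Set.indicator_of_mem hy _
  · exact contDiffAt_const.congr_of_eventuallyEq
      (indicator_comp_mul_eventuallyEq_zero hE h hu hu0 hε hφ0 hx)

lemma hasCompactSupport_indicator_of_isBounded {V : Type*} [NormedAddCommGroup V]
    [ProperSpace V] {E : Set V}
    (hE : Bornology.IsBounded E) (f : V → ℝ) : HasCompactSupport (E.indicator f) :=
  HasCompactSupport.of_support_subset_isCompact hE.isCompact_closure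
    (Set.support_indicator_subset.trans subset_closure)

/-- The integral of a directional derivative of a compactly supported `C¹` function vanishes. -/
lemma integral_fderiv_apply_eq_zero [FiniteDimensional ℝ V] [MeasurableSpace V] [BorelSpace V]
    (μ : Measure V) [μ.IsAddHaarMeasure] {f : V → ℝ} (hf : ContDiff ℝ 1 f)
    (hc : HasCompactSupport f) (e : V) : ∫ x, fderiv ℝ f x e ∂μ = 0 := by
  have hint : Integrable (fun x => fderiv ℝ f x e) μ :=
    ((hf.continuous_fderiv one_ne_zero).clm_apply continuous_const).integrable_of_hasCompactSupport
      (hc.fderiv_apply ℝ e)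
  have key := integral_mul_fderiv_eq_neg_fderiv_mul_of_integrable (μ := μ) (f := f)
    (g := fun _ => (1 : ℝ)) (v := e) (by simpa using hint) (by simp)
    (by simpa using hf.continuous.integrable_of_hasCompactSupport hc)
    (fun x _ => hf.differentiable one_ne_zero x) (fun x _ => differentiableAt_const _)
  simpa using key

end Cutoff

section Truncation

/-- A smooth even function, equal to `0` on `[-ε, ε]` and to `1` where `2 * ε ^ 2 ≤ t ^ 2`. -/
def evenCutoff (ε t : ℝ) : ℝ := Real.smoothTransition (t ^ 2 / ε ^ 2 - 1)

lemma contDiff_evenCutoff (ε : ℝ) {n : ℕ∞} : ContDiff ℝ n (evenCutoff ε) :=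
  Real.smoothTransition.contDiff.comp (by fun_prop)

lemma evenCutoff_nonneg (ε t : ℝ) : 0 ≤ evenCutoff ε t := Real.smoothTransition.nonneg _

lemma evenCutoff_le_one (ε t : ℝ) : evenCutoff ε t ≤ 1 := Real.smoothTransition.le_one _

lemma evenCutoff_eq_zero {ε t : ℝ} (hε : 0 < ε) (ht : |t| < ε) : evenCutoff ε t = 0 := by
  apply Real.smoothTransition.zero_of_nonpos
  rw [sub_nonpos, div_le_one (by positivity)]
  exact sq_le_sq' (by linarith [(abs_lt.1 ht).1]) (abs_lt.1 ht).2.le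

lemma evenCutoff_pos {ε t : ℝ} (hε : 0 < ε) (ht : ε < |t|) : 0 < evenCutoff ε t := by
  apply Real.smoothTransition.pos_of_pos
  rw [sub_pos, one_lt_div (by positivity), ← sq_abs t]
  gcongr

lemma evenCutoff_eq_one {ε t : ℝ} (hε : 0 < ε) (ht : 2 * ε ≤ |t|) : evenCutoff ε t = 1 := by
  apply Real.smoothTransition.one_of_one_le
  rw [le_sub_iff_add_le, le_div_iff₀ (by positivity), ← sq_abs t]
  nlinarith [mul_self_le_mul_self (by positivity) ht]

lemma evenCutoff_anti {δ ε : ℝ} (hδ : 0 < δ) (h : δ ≤ ε) (t : ℝ) :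
    evenCutoff ε t ≤ evenCutoff δ t := by
  apply Real.smoothTransition.monotone
  gcongr

lemma evenCutoff_le_deriv_mul_self (ε t : ℝ) :
    evenCutoff ε t ≤ deriv (fun s => evenCutoff ε s * s) t := by
  have hd : HasDerivAt (evenCutoff ε)
      (deriv Real.smoothTransition (t ^ 2 / ε ^ 2 - 1) * (2 * t / ε ^ 2)) t := by
    have h1 : HasDerivAt (fun s : ℝ => s ^ 2 / ε ^ 2 - 1) (2 * t / ε ^ 2) t := by
      simpa using ((hasDerivAt_pow 2 t).div_const (ε ^ 2)).sub_const 1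
    have h2 : DifferentiableAt ℝ Real.smoothTransition (t ^ 2 / ε ^ 2 - 1) :=
      (Real.smoothTransition.contDiffAt (n := 1)).differentiableAt (by simp)
    exact h2.hasDerivAt.comp t h1
  have hd' := hd.mul (hasDerivAt_id t)
  have hnn : 0 ≤ deriv Real.smoothTransition (t ^ 2 / ε ^ 2 - 1) :=
    Real.smoothTransition.monotone.deriv_nonneg
  have heq : deriv (fun s => evenCutoff ε s * s) t =
      deriv Real.smoothTransition (t ^ 2 / ε ^ 2 - 1) * (2 * t ^ 2 / ε ^ 2) + evenCutoff ε t := by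
    rw [show (fun s => evenCutoff ε s * s) = evenCutoff ε * id from rfl, hd'.deriv]
    simp only [id]
    ring
  rw [heq]
  have : 0 ≤ deriv Real.smoothTransition (t ^ 2 / ε ^ 2 - 1) * (2 * t ^ 2 / ε ^ 2) := by
    positivity
  linarith

lemma abs_self_sub_evenCutoff_mul_self_le {ε : ℝ} (hε : 0 < ε) (t : ℝ) :
    |t - evenCutoff ε t * t| ≤ 2 * ε := by
  rw [← one_sub_mul, abs_mul, abs_of_nonneg (by linarith [evenCutoff_le_one ε t])]
  rcases le_or_gt (2 * ε) |t| with h | h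
  · rw [evenCutoff_eq_one hε h]
    simpa using hε.le
  · nlinarith [evenCutoff_nonneg ε t, abs_nonneg t]

end Truncation

section Energy

variable {ι : Type*} [Fintype ι] {E : Set (EuclideanSpace ℝ ι)}
  {u p : EuclideanSpace ℝ ι → ℝ}

lemma contDiffOn_fderiv_apply (hE : IsOpen E) (hu2 : ContDiffOn ℝ 2 u E)
    (e : EuclideanSpace ℝ ι) : ContDiffOn ℝ 1 (fun y => fderiv ℝ u y e) E :=
  (hu2.fderiv_of_isOpen hE (by norm_num)).clm_apply contDiffOn_const

variable [DecidableEq ι]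

/-- A function with zero boundary values which is orthogonal to its Laplacian has truncated
Dirichlet energy of the order of the truncation level. -/
lemma setIntegral_evenCutoff_mul_sum_sq_le (hE : IsOpen E) (hb : Bornology.IsBounded E)
    (hu : ContinuousOn u (closure E)) (hu0 : ∀ x ∈ frontier E, u x = 0)
    (hu2 : ContDiffOn ℝ 2 u E)
    (hlap : ∀ x ∈ E, ∑ i, fderiv ℝ (fun y => fderiv ℝ u y (EuclideanSpace.single i 1)) x
      (EuclideanSpace.single i 1) = p x)
    (hint : IntegrableOn (fun x => u x * p x) E) (horth : ∫ x in E, u x * p x = 0)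
    {M : ℝ} (hM : ∀ x ∈ E, |p x| ≤ M) {δ ε : ℝ} (hδ : 0 < δ) (hδε : δ ≤ ε) :
    ∫ x, E.indicator (fun x => evenCutoff ε (u x) *
      ∑ i, fderiv ℝ u x (EuclideanSpace.single i 1) ^ 2) x ≤ 2 * δ * M * volume.real E := by
  set d : ι → EuclideanSpace ℝ ι → ℝ :=
    fun i x => fderiv ℝ u x (EuclideanSpace.single i 1) with hd
  have hd1 (i : ι) : ContDiffOn ℝ 1 (d i) E := contDiffOn_fderiv_apply hE hu2 _
  have hu1 : ContDiffOn ℝ 1 u E := hu2.of_le (by norm_num)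
  set F : ℝ → ℝ := fun t => evenCutoff δ t * t with hF
  have hF1 : ContDiff ℝ 1 F := (contDiff_evenCutoff δ (n := 1)).mul contDiff_id
  set Φ : ι → EuclideanSpace ℝ ι → ℝ := fun i => E.indicator fun x => F (u x) * d i x with hΦ
  have hΦ1 (i : ι) : ContDiff ℝ 1 (Φ i) :=
    contDiff_indicator_comp_mul hE hu hu0 hu1 (hd1 i) hF1 hδ
      fun t ht => by simp [hF, evenCutoff_eq_zero hδ ht]
  have hΦc (i : ι) : HasCompactSupport (Φ i) := hasCompactSupport_indicator_of_isBounded hb _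
  have hΦint (i : ι) :
      Integrable (fun x => fderiv ℝ (Φ i) x (EuclideanSpace.single i 1)) volume :=
    (((hΦ1 i).continuous_fderiv one_ne_zero).clm_apply
      continuous_const).integrable_of_hasCompactSupport ((hΦc i).fderiv_apply ℝ _)
  have hΦE (i : ι) : ∀ x ∈ E, fderiv ℝ (Φ i) x (EuclideanSpace.single i 1) =
      deriv F (u x) * d i x ^ 2 +
        F (u x) * fderiv ℝ (d i) x (EuclideanSpace.single i 1) := by
    intro x hx
    have hmem := hE.mem_nhds hx
    have hev : Φ i =ᶠ[nhds x] fun y => F (u y) * d i y := by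
      filter_upwards [hmem] with y hy
      exact Set.indicator_of_mem hy _
    have hux := ((hu1.contDiffAt hmem).differentiableAt one_ne_zero).hasFDerivAt
    have hdx := (((hd1 i).contDiffAt hmem).differentiableAt one_ne_zero).hasFDerivAt
    have hFx := ((hF1.differentiable one_ne_zero) (u x)).hasDerivAt
    have hmul := (hFx.comp_hasFDerivAt x hux).mul hdx
    rw [hev.fderiv_eq, show (fun y => F (u y) * d i y) = (F ∘ u) * d i from rfl, hmul.fderiv]
    simp [hd]
    ring
  have hΦ0 (i : ι) : ∀ x, x ∉ E → fderiv ℝ (Φ i) x (EuclideanSpace.single i 1) = 0 := by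
    intro x hx
    rw [(indicator_comp_mul_eventuallyEq_zero hE (d i) hu hu0 hδ
      (fun t ht => by simp [hF, evenCutoff_eq_zero hδ ht]) hx).fderiv_eq]
    simp
  have hdiv0 : ∫ x in E, ∑ i, fderiv ℝ (Φ i) x (EuclideanSpace.single i 1) = 0 := by
    rw [setIntegral_eq_integral_of_forall_compl_eq_zero
      fun x hx => Finset.sum_eq_zero fun i _ => hΦ0 i x hx, integral_finsetSum _ fun i _ => hΦint i]
    exact Finset.sum_eq_zero fun i _ => integral_fderiv_apply_eq_zero _ (hΦ1 i) (hΦc i) _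
  have hdivint : IntegrableOn
      (fun x => ∑ i, fderiv ℝ (Φ i) x (EuclideanSpace.single i 1)) E :=
    (integrable_finsetSum _ fun i _ => hΦint i).integrableOn
  have hsubint : IntegrableOn
      (fun x => ∑ i, fderiv ℝ (Φ i) x (EuclideanSpace.single i 1) - u x * p x) E :=
    hdivint.sub hint
  have hconst : IntegrableOn (fun _ => 2 * δ * M) E :=
    integrableOn_const hb.measure_lt_top.ne
  rw [integral_indicator hE.measurableSet]
  have hpt : ∀ x ∈ E, evenCutoff ε (u x) * ∑ i, d i x ^ 2 ≤
      (∑ i, fderiv ℝ (Φ i) x (EuclideanSpace.single i 1) - u x * p x) + 2 * δ * M := by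
    intro x hx
    have h1 : ∑ i, fderiv ℝ (Φ i) x (EuclideanSpace.single i 1) =
        deriv F (u x) * ∑ i, d i x ^ 2 + F (u x) * p x := by
      rw [Finset.sum_congr rfl fun i _ => hΦE i x hx, Finset.sum_add_distrib, ← Finset.mul_sum,
        ← Finset.mul_sum, hlap x hx]
    have h2 : evenCutoff ε (u x) * ∑ i, d i x ^ 2 ≤ deriv F (u x) * ∑ i, d i x ^ 2 :=
      mul_le_mul_of_nonneg_right ((evenCutoff_anti hδ hδε _).trans
        (evenCutoff_le_deriv_mul_self δ _)) (Finset.sum_nonneg fun i _ => sq_nonneg _)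
    have h3 : (u x - F (u x)) * p x ≤ 2 * δ * M := by
      refine (le_abs_self _).trans ?_
      rw [abs_mul]
      exact mul_le_mul (abs_self_sub_evenCutoff_mul_self_le hδ _) (hM x hx) (abs_nonneg _)
        (by positivity)
    rw [h1]
    linarith
  calc ∫ x in E, evenCutoff ε (u x) * ∑ i, d i x ^ 2
      ≤ ∫ x in E, ((∑ i, fderiv ℝ (Φ i) x (EuclideanSpace.single i 1) - u x * p x)
          + 2 * δ * M) := by
        refine integral_mono_of_nonneg ?_ (hsubint.add hconst)
          (ae_restrict_of_forall_mem hE.measurableSet hpt)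
        exact Filter.Eventually.of_forall fun x =>
          mul_nonneg (evenCutoff_nonneg _ _) (Finset.sum_nonneg fun i _ => sq_nonneg _)
    _ = 2 * δ * M * volume.real E := by
        rw [integral_add hsubint hconst, integral_sub hdivint hint, hdiv0, horth]
        simp [mul_comm]

/-- A function on a bounded open set with zero boundary values which is orthogonal to its
(bounded) Laplacian vanishes. -/
theorem eqOn_zero_of_setIntegral_mul_laplacian_eq_zero [Nonempty ι] (hE : IsOpen E)
    (hb : Bornology.IsBounded E)
    (hu : ContinuousOn u (closure E)) (hu0 : ∀ x ∈ frontier E, u x = 0)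
    (hu2 : ContDiffOn ℝ 2 u E)
    (hlap : ∀ x ∈ E, ∑ i, fderiv ℝ (fun y => fderiv ℝ u y (EuclideanSpace.single i 1)) x
      (EuclideanSpace.single i 1) = p x)
    (hint : IntegrableOn (fun x => u x * p x) E) (horth : ∫ x in E, u x * p x = 0)
    {M : ℝ} (hM : ∀ x ∈ E, |p x| ≤ M) : Set.EqOn u 0 E := by
  have hu1 : ContDiffOn ℝ 1 u E := hu2.of_le (by norm_num)
  set G : EuclideanSpace ℝ ι → ℝ :=
    fun x => ∑ i, fderiv ℝ u x (EuclideanSpace.single i 1) ^ 2 with hG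
  have hG0 : ContDiffOn ℝ 0 G E :=
    ContDiffOn.sum fun i _ =>
      ((contDiffOn_fderiv_apply hE hu2 (EuclideanSpace.single i 1)).of_le (by norm_num)).pow 2
  have hGnn (x) : 0 ≤ G x := Finset.sum_nonneg fun i _ => sq_nonneg _
  have henergy (ε : ℝ) (hε : 0 < ε) (x) :
      E.indicator (fun x => evenCutoff ε (u x) * G x) x = 0 := by
    have hcont : Continuous (E.indicator fun x => evenCutoff ε (u x) * G x) :=
      contDiff_zero.1 (contDiff_indicator_comp_mul hE hu hu0 (hu1.of_le (by norm_num)) hG0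
        (contDiff_evenCutoff ε (n := 0)) hε fun t ht => evenCutoff_eq_zero hε ht)
    by_contra hne
    have hpos := hcont.integral_pos_of_hasCompactSupport_nonneg_nonzero (μ := volume)
      (hasCompactSupport_indicator_of_isBounded hb _)
      (fun y => Set.indicator_nonneg (fun z _ => mul_nonneg (evenCutoff_nonneg _ _) (hGnn z)) y)
      hne
    have hlim : Filter.Tendsto (fun δ : ℝ => 2 * δ * M * volume.real E)
        (nhdsWithin 0 (Set.Ioi 0)) (nhds 0) := by
      have : Continuous fun δ : ℝ => 2 * δ * M * volume.real E := by fun_prop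
      simpa using (this.tendsto 0).mono_left nhdsWithin_le_nhds
    refine hpos.not_ge (ge_of_tendsto hlim ?_)
    filter_upwards [Ioc_mem_nhdsGT hε] with δ hδ
    exact setIntegral_evenCutoff_mul_sum_sq_le hE hb hu hu0 hu2 hlap hint horth hM hδ.1 hδ.2
  have hgrad : ∀ x ∈ E, u x ≠ 0 → fderiv ℝ u x = 0 := by
    intro x hx hux
    have h1 := henergy (|u x| / 2) (by positivity) x
    have h2 : 0 < evenCutoff (|u x| / 2) (u x) :=
      evenCutoff_pos (by positivity) (half_lt_self (by positivity))
    rw [Set.indicator_of_mem hx, mul_eq_zero, or_iff_right h2.ne', hG,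
      Finset.sum_eq_zero_iff_of_nonneg fun i _ => sq_nonneg _] at h1
    apply ContinuousLinearMap.coe_injective
    refine (EuclideanSpace.basisFun ι ℝ).toBasis.ext fun i => ?_
    simpa using h1 i (Finset.mem_univ i)
  intro x hx
  by_contra hux
  change u x ≠ 0 at hux
  set ε := |u x| / 2 with hεdef
  have hε : 0 < ε := by positivity
  set ψ : EuclideanSpace ℝ ι → ℝ := E.indicator fun x => evenCutoff ε (u x) * 1 with hψ
  have hcut1 : ContDiff ℝ 1 (evenCutoff ε) := contDiff_evenCutoff ε (n := 1)
  have hcut0 : ∀ t, |t| < ε → evenCutoff ε t = 0 := fun t ht => evenCutoff_eq_zero hε ht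
  have hψ1 : ContDiff ℝ 1 ψ :=
    contDiff_indicator_comp_mul hE hu hu0 hu1 contDiffOn_const hcut1 hε hcut0
  have hψd (y) : fderiv ℝ ψ y = 0 := by
    by_cases hy : y ∈ E
    · have hmem := hE.mem_nhds hy
      have hev : ψ =ᶠ[nhds y] evenCutoff ε ∘ u := by
        filter_upwards [hmem] with z hz
        simp [hψ, hz]
      have huy := ((hu1.contDiffAt hmem).differentiableAt one_ne_zero).hasFDerivAt
      have hcy := ((hcut1.differentiable one_ne_zero) (u y)).hasDerivAt
      rw [hev.fderiv_eq, (hcy.comp_hasFDerivAt y huy).fderiv]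
      by_cases huy0 : u y = 0
      · have : evenCutoff ε =ᶠ[nhds (u y)] fun _ => 0 := by
          rw [huy0]
          filter_upwards [Metric.ball_mem_nhds (0 : ℝ) hε] with t ht
          exact hcut0 t (by simpa using ht)
        simp [this.deriv_eq]
      · simp [hgrad y hy huy0]
    · rw [(indicator_comp_mul_eventuallyEq_zero hE (fun _ => 1) hu hu0 hε hcut0 hy).fderiv_eq]
      simp
  have hbdd : ∃ y, y ∉ E := by
    by_contra! hall
    exact NormedSpace.unbounded_univ ℝ (EuclideanSpace ℝ ι)
      (by rwa [Set.eq_univ_of_forall hall] at hb)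
  obtain ⟨y, hy⟩ := hbdd
  have hxy := is_const_of_fderiv_eq_zero (hψ1.differentiable one_ne_zero) hψd x y
  have hpos : 0 < evenCutoff ε (u x) := evenCutoff_pos hε (half_lt_self (by positivity))
  simp [hψ, hx, hy] at hxy
  exact hpos.ne' hxy

end Energy

lemma lapWithin_eq_sum_fderiv {E : Set ℝ²} (hE : IsOpen E) {v : ℝ² → ℝ}
    (hv : ContDiffOn ℝ 2 v E) {x : ℝ²} (hx : x ∈ E) :
    lapWithin E v x = ∑ i, fderiv ℝ (fun y => fderiv ℝ v y (EuclideanSpace.single i 1)) x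
      (EuclideanSpace.single i 1) := by
  refine Finset.sum_congr rfl fun i _ => ?_
  rw [iteratedFDerivWithin_of_isOpen 2 hE hx, iteratedFDeriv_two_apply]
  have hd : DifferentiableAt ℝ (fderiv ℝ v) x :=
    ((hv.fderiv_of_isOpen (m := 1) hE (by norm_num)).contDiffAt
      (hE.mem_nhds hx)).differentiableAt one_ne_zero
  rw [fderiv_clm_apply hd (differentiableAt_const _)]
  simp

lemma lapWithin_sub {E : Set ℝ²} (hE : IsOpen E) {v w : ℝ² → ℝ}
    (hv : ContDiffOn ℝ 2 v E) (hw : ContDiffOn ℝ 2 w E) {x : ℝ²} (hx : x ∈ E) :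
    lapWithin E (v - w) x = lapWithin E v x - lapWithin E w x := by
  unfold lapWithin
  rw [← Finset.sum_sub_distrib]
  refine Finset.sum_congr rfl fun i _ => ?_
  rw [iteratedFDerivWithin_sub_apply (hv x hx) (hw x hx) hE.uniqueDiffOn hx]
  rfl

lemma IsPolyDeg.continuous {k : ℕ} {p : ℝ² → ℝ} (hp : IsPolyDeg k p) : Continuous p := by
  obtain ⟨q, -, hq⟩ := hp
  rw [funext hq]
  exact (MvPolynomial.continuous_eval q).comp (by fun_prop)

lemma IsPolyDeg.sub {k : ℕ} {p q : ℝ² → ℝ} (hp : IsPolyDeg k p) (hq : IsPolyDeg k q) :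
    IsPolyDeg k (p - q) := by
  obtain ⟨P, hP, hpP⟩ := hp
  obtain ⟨Q, hQ, hqQ⟩ := hq
  exact ⟨P - Q, (MvPolynomial.totalDegree_sub P Q).trans (max_le hP hQ),
    fun x => by simp [hpP, hqQ]⟩

/-- unisolvence: let `E` be a bounded Lipschitz domain and let
`v ∈ H¹(E)` satisfy `Δv ∈ P_m(E)` and `v|_{∂E} = g`.  Then `v` is uniquely
determined by its boundary values together with the moments `∫_E v q`,
`q ∈ P_m(E)`: two such functions with the same boundary data and the same
moments coincide on `E`. -/
theorem vem_unisolvence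
    (E : Set ℝ²) (hEo : IsOpen E) (hEc : IsConnected E) (hEb : Bornology.IsBounded E)
    (m : ℕ) (v w : ℝ² → ℝ)
    (hvreg : ContinuousOn v (closure E)) (hwreg : ContinuousOn w (closure E))
    (hvsmooth : ContDiffOn ℝ 2 v E) (hwsmooth : ContDiffOn ℝ 2 w E)
    (hvlap : ∃ p : ℝ² → ℝ, IsPolyDeg m p ∧ ∀ x ∈ E, lapWithin E v x = p x)
    (hwlap : ∃ p : ℝ² → ℝ, IsPolyDeg m p ∧ ∀ x ∈ E, lapWithin E w x = p x)
    (hbdry : Set.EqOn v w (frontier E))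
    (hmoments : ∀ q : ℝ² → ℝ, IsPolyDeg m q →
      ∫ x in E, v x * q x = ∫ x in E, w x * q x) :
    Set.EqOn v w (closure E) := by
  obtain ⟨p, hp, hvp⟩ := hvlap
  obtain ⟨q, hq, hwq⟩ := hwlap
  have hpq : IsPolyDeg m (p - q) := hp.sub hq
  have hcomp : IsCompact (closure E) := hEb.isCompact_closure
  have hint {f : ℝ² → ℝ} (hf : ContinuousOn f (closure E)) :
      IntegrableOn (fun x => f x * (p - q) x) E :=
    ((hf.mul hpq.continuous.continuousOn).integrableOn_compact hcomp).mono_set subset_closure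
  obtain ⟨M, hM⟩ := hcomp.exists_bound_of_continuousOn hpq.continuous.continuousOn
  have horth : ∫ x in E, (v - w) x * (p - q) x = 0 := by
    simp only [Pi.sub_apply v w, sub_mul]
    rw [integral_sub (hint hvreg) (hint hwreg), hmoments _ hpq, sub_self]
  have hsub : ContDiffOn ℝ 2 (v - w) E := hvsmooth.sub hwsmooth
  have hzero : Set.EqOn (v - w) 0 E := by
    refine eqOn_zero_of_setIntegral_mul_laplacian_eq_zero (p := p - q) hEo hEb (hvreg.sub hwreg)
      (fun x hx => sub_eq_zero.2 (hbdry hx)) hsub (fun x hx => ?_)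
      (hint (hvreg.sub hwreg)) horth fun x hx => hM x (subset_closure hx)
    rw [← lapWithin_eq_sum_fderiv hEo hsub hx, lapWithin_sub hEo hvsmooth hwsmooth hx, hvp x hx, hwq x hx]
    rfl
  have hEvw : Set.EqOn v w E := fun x hx => sub_eq_zero.1 (hzero hx)
  exact hEvw.of_subset_closure hvreg hwreg subset_closure le_rfl
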